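/- Under the setting of the APG-type method: E, F real finite-dimensional inner product spaces, A: E → F linear, φ: F → ℝ convex differentiable with L_φ-Lipschitz gradient, h: E → ℝ convex, F_obj(x) = φ(Ax) + h(x), x* a minimizer of F_obj, θ₀ = 0, θ_k ∈ (0, 1) satisfying 1 − θ_k = √θ_k (1 − θ_{k−1}) for k ≥ 1, y_k = θ_k x_k − √θ_k (θ_{k−1} x_{k−1} − x_k), x_{k+1} a minimizer of x ↦ ⟨∇φ(A y_k), A(x − y_k)⟩ + (L_φ/2)‖A(x − y_k)‖² + h(x), and z_k = A(θ_{k−1} x_{k−1} − x_k + (1 − θ_{k−1}) x*); then for every k ≥ 1 the one-step recursion holds: F_obj(x_{k+1}) − F_obj(x*) + (L_φ/2)‖z_{k+1}‖² ≤ θ_k (F_obj(x_k) − F_obj(x*) + (L_φ/2)‖z_k‖²). -/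

import Mathlib

open RealInnerProductSpace

lemma aux_line {F : Type*} [NormedAddCommGroup F] [InnerProductSpace ℝ F] [FiniteDimensional ℝ F]
    (φ : F → ℝ) (hφdiff : Differentiable ℝ φ) (u d : F) (t : ℝ) :
    HasDerivAt (fun s : ℝ => φ (u + s • d)) ⟪gradient φ (u + t • d), d⟫ t := by
  have h1 := (hφdiff (u + t • d)).hasGradientAt.hasFDerivAt
  have h2 : HasDerivAt (fun s : ℝ => u + s • d) d t := by
    simpa using ((hasDerivAt_id t).smul_const d).const_add u
  have h3 := h1.comp_hasDerivAt t h2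
  simpa [Function.comp_def] using h3

lemma aux_descent {F : Type*} [NormedAddCommGroup F] [InnerProductSpace ℝ F]
    [FiniteDimensional ℝ F]
    (φ : F → ℝ) (hφdiff : Differentiable ℝ φ) (L : ℝ)
    (hLip : ∀ u v : F, ‖gradient φ u - gradient φ v‖ ≤ L * ‖u - v‖) (u d : F) :
    φ (u + d) ≤ φ u + ⟪gradient φ u, d⟫ + L / 2 * ‖d‖ ^ 2 := by
  have hd : ∀ t : ℝ, HasDerivAt
      (fun s : ℝ => φ (u + s • d) - s * ⟪gradient φ u, d⟫ - L / 2 * ‖d‖ ^ 2 * s ^ 2)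
      (⟪gradient φ (u + t • d), d⟫ - ⟪gradient φ u, d⟫ - L * ‖d‖ ^ 2 * t) t := by
    intro t
    have h1 := ((aux_line φ hφdiff u d t).sub
      ((hasDerivAt_id t).mul_const ⟪gradient φ u, d⟫)).sub
      ((hasDerivAt_pow 2 t).const_mul (L / 2 * ‖d‖ ^ 2))
    refine HasDerivAt.congr_deriv h1 ?_
    push_cast
    ring
  have hanti := antitoneOn_of_deriv_nonpos (convex_Icc (0:ℝ) 1)
    (fun t _ => (hd t).continuousAt.continuousWithinAt)
    (fun t _ => (hd t).differentiableAt.differentiableWithinAt)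
    (by
      intro t ht
      rw [interior_Icc] at ht
      rw [(hd t).deriv, ← inner_sub_left]
      have h1 := real_inner_le_norm (gradient φ (u + t • d) - gradient φ u) d
      have h2 := hLip (u + t • d) u
      rw [add_sub_cancel_left, norm_smul, Real.norm_of_nonneg ht.1.le] at h2
      have h3 := mul_le_mul_of_nonneg_right h2 (norm_nonneg d)
      nlinarith)
  have := hanti (a := 0) (b := 1) (by simp) (by simp) zero_le_one
  simp only [one_smul, zero_smul, add_zero] at this
  linarith

lemma aux_grad {F : Type*} [NormedAddCommGroup F] [InnerProductSpace ℝ F] [FiniteDimensional ℝ F]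
    (φ : F → ℝ) (hφconv : ConvexOn ℝ Set.univ φ) (hφdiff : Differentiable ℝ φ) (u d : F) :
    φ u + ⟪gradient φ u, d⟫ ≤ φ (u + d) := by
  have hc : ConvexOn ℝ Set.univ (fun s : ℝ => φ (u + s • d)) := by
    refine ⟨convex_univ, fun a _ b _ p q hp hq hpq => ?_⟩
    have := hφconv.2 (Set.mem_univ (u + a • d)) (Set.mem_univ (u + b • d)) hp hq hpq
    refine le_trans (le_of_eq ?_) this
    refine congrArg φ ?_
    obtain rfl : q = 1 - p := by linarith
    simp only [smul_eq_mul]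
    module
  have h0 := aux_line φ hφdiff u d 0
  have := hc.le_slope_of_hasDerivAt (Set.mem_univ 0) (Set.mem_univ 1) zero_lt_one h0
  simp only [slope, one_smul, zero_smul, add_zero, sub_zero, inv_one, vsub_eq_sub] at this
  linarith

theorem apg_one_step_recursion {E F : Type*}
    [NormedAddCommGroup E] [InnerProductSpace ℝ E] [FiniteDimensional ℝ E]
    [NormedAddCommGroup F] [InnerProductSpace ℝ F] [FiniteDimensional ℝ F]
    (A : E →ₗ[ℝ] F) (φ : F → ℝ) (h : E → ℝ) (Lφ : ℝ)
    (hφconv : ConvexOn ℝ Set.univ φ) (hφdiff : Differentiable ℝ φ)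
    (hLip : ∀ u v : F, ‖gradient φ u - gradient φ v‖ ≤ Lφ * ‖u - v‖)
    (hconv : ConvexOn ℝ Set.univ h)
    (Fobj : E → ℝ) (hFobj : ∀ x, Fobj x = φ (A x) + h x)
    (xstar : E) (hstar : ∀ x, Fobj xstar ≤ Fobj x)
    (θ : ℕ → ℝ) (x y : ℕ → E)
    (hθ0 : θ 0 = 0)
    (hθ : ∀ k, 1 ≤ k → θ k ∈ Set.Ioo (0:ℝ) 1 ∧
      1 - θ k = Real.sqrt (θ k) * (1 - θ (k - 1)))
    (hy : ∀ k, 1 ≤ k →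
      y k = θ k • x k - Real.sqrt (θ k) • (θ (k - 1) • x (k - 1) - x k))
    (hx : ∀ k, 1 ≤ k → ∀ u : E,
      ⟪gradient φ (A (y k)), A (x (k + 1) - y k)⟫
          + Lφ / 2 * ‖A (x (k + 1) - y k)‖ ^ 2 + h (x (k + 1))
        ≤ ⟪gradient φ (A (y k)), A (u - y k)⟫
          + Lφ / 2 * ‖A (u - y k)‖ ^ 2 + h u)
    (z : ℕ → F)
    (hz : ∀ k, z k = A (θ (k - 1) • x (k - 1) - x k + (1 - θ (k - 1)) • xstar)) :
    ∀ k : ℕ, 1 ≤ k →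
      Fobj (x (k + 1)) - Fobj xstar + Lφ / 2 * ‖z (k + 1)‖ ^ 2
        ≤ θ k * (Fobj (x k) - Fobj xstar + Lφ / 2 * ‖z k‖ ^ 2) := by
  intro k hk
  obtain ⟨⟨h0, h1⟩, hθk⟩ := hθ k hk
  have hs := Real.sq_sqrt h0.le
  set s := Real.sqrt (θ k) with hsdef
  set g := gradient φ (A (y k)) with hg
  set p := x (k + 1) with hp
  obtain ⟨u, hu⟩ : ∃ u, u = θ k • x k + (1 - θ k) • xstar := ⟨_, rfl⟩
  have huy : A (u - y k) = s • z k := by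
    rw [hz k, ← map_smul, hu, hy k hk, hθk]
    congr 1
    module
  have hzk : z (k + 1) = A (u - p) := by
    rw [hz (k + 1), hu]
    simp only [Nat.add_sub_cancel]
    congr 1
    module
  set a := A (p - y k) with ha
  set d := A (u - p) with hd
  have had : A (u - y k) = a + d := by rw [ha, hd, ← map_add]; congr 1; abel
  have key : ∀ t : ℝ, 0 < t → t < 1 →
      0 ≤ ⟪g, d⟫ + Lφ * ⟪a, d⟫ + h u - h p + t * (Lφ / 2 * ‖d‖ ^ 2) := by
    intro t ht ht1
    have e1 := hx k hk ((1 - t) • p + t • u)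
    have e2 : A ((1 - t) • p + t • u - y k) = a + t • d := by
      rw [ha, hd, ← map_smul, ← map_add]; congr 1; module
    have e3 := hconv.2 (Set.mem_univ p) (Set.mem_univ u) (sub_nonneg.2 ht1.le) ht.le (by ring)
    rw [e2, ← ha, inner_add_right, norm_add_sq_real, norm_smul, inner_smul_right,
      inner_smul_right, mul_pow, Real.norm_eq_abs, sq_abs] at e1
    simp only [smul_eq_mul] at e3
    refine le_of_mul_le_mul_left (a := t) ?_ ht
    linarith
  have key0 : 0 ≤ ⟪g, d⟫ + Lφ * ⟪a, d⟫ + h u - h p := by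
    by_contra hneg
    push Not at hneg
    set c := ⟪g, d⟫ + Lφ * ⟪a, d⟫ + h u - h p
    set B := Lφ / 2 * ‖d‖ ^ 2
    have hlim : Filter.Tendsto (fun t : ℝ => c + t * B) (nhdsWithin 0 (Set.Ioi 0)) (nhds c) := by
      have : Continuous (fun t : ℝ => c + t * B) := by fun_prop
      simpa using (this.tendsto 0).mono_left nhdsWithin_le_nhds
    have : 0 ≤ c := by
      refine ge_of_tendsto hlim ?_
      filter_upwards [Ioo_mem_nhdsGT (zero_lt_one' ℝ)] with t ht
      exact key t ht.1 ht.2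
    linarith
  have f1 := aux_descent φ hφdiff Lφ hLip (A (y k)) a
  have f2 := aux_grad φ hφconv hφdiff (A (y k)) (a + d)
  have g1 : A (y k) + a = A p := by rw [ha, ← map_add]; congr 1; abel
  have g2 : A (y k) + (a + d) = θ k • A (x k) + (1 - θ k) • A xstar := by
    rw [← had, ← map_add, ← map_smul, ← map_smul, ← map_add, ← hu]; congr 1; abel
  have f3 := hφconv.2 (Set.mem_univ (A (x k))) (Set.mem_univ (A xstar)) h0.le
    (sub_nonneg.2 h1.le) (by ring)
  have f4 := hconv.2 (Set.mem_univ (x k)) (Set.mem_univ xstar) h0.le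
    (sub_nonneg.2 h1.le) (by ring)
  rw [← hu] at f4
  rw [g1] at f1
  rw [g2] at f2
  rw [← hg] at f1 f2
  rw [inner_add_right] at f2
  simp only [smul_eq_mul] at f3 f4
  have n1 : θ k * ‖z k‖ ^ 2 = ‖a‖ ^ 2 + 2 * ⟪a, d⟫ + ‖d‖ ^ 2 := by
    rw [← norm_add_sq_real, ← had, huy, norm_smul, mul_pow, Real.norm_eq_abs, sq_abs, hs]
  have n2 : θ k * (Lφ / 2 * ‖z k‖ ^ 2) = Lφ / 2 * (‖a‖ ^ 2 + 2 * ⟪a, d⟫ + ‖d‖ ^ 2) := by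
    rw [← n1]; ring
  rw [hzk, hFobj, hFobj, hFobj, mul_add, n2]
  linarith
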